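/- arXiv:math/0503348 — 2 statements merged into one kernel-verified Lean document; each statement's English description precedes it below -/
import Mathlib

section
/- Let U ⊆ ℂⁿ be open and let wᵢ, aᵢ, bᵢ : U → ℂ (1 ≤ i ≤ n) be holomorphic functions satisfying dω = ω ∧ α and dα = ω ∧ β, i.e. ∂ᵢwⱼ − ∂ⱼwᵢ = wᵢaⱼ − wⱼaᵢ and ∂ᵢaⱼ − ∂ⱼaᵢ = wᵢbⱼ − wⱼbᵢ on U for all i, j. Let Γ : U → U be holomorphic, f : U → ℂ a nowhere-vanishing holomorphic function with Γ*ω = f·ω, and g : U → ℂ holomorphic with (Γ*α)ᵢ − aᵢ + ∂ᵢf/f = g·wᵢ for all i. Then the 1-form f·Γ*β − β − g·α + dg is proportional to ω: setting Bᵢ := f·(Γ*β)ᵢ − bᵢ − g·aᵢ + ∂ᵢg, one has Bᵢ(x)·wⱼ(x) = Bⱼ(x)·wᵢ(x) for all i, j and all x ∈ U. -/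
open scoped BigOperators

/-- The `i`-th complex partial derivative of `f : ℂⁿ → ℂ` at `x`. -/
noncomputable def pd {n : ℕ} (i : Fin n) (f : (Fin n → ℂ) → ℂ) (x : Fin n → ℂ) : ℂ :=
  fderiv ℂ f x (Pi.single i 1)

/-- The `i`-th component of the pullback `Γ*η` of the 1-form `η = Σⱼ hⱼ dxⱼ`
under `Γ : ℂⁿ → ℂⁿ`: `(Γ*η)ᵢ = Σⱼ (hⱼ ∘ Γ) · ∂ᵢΓⱼ`. -/
noncomputable def pullback1 {n : ℕ} (Γ : (Fin n → ℂ) → (Fin n → ℂ))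
    (h : Fin n → (Fin n → ℂ) → ℂ) (i : Fin n) (x : Fin n → ℂ) : ℂ :=
  ∑ j, h j (Γ x) * pd i (fun y => Γ y j) x

open Metric MeasureTheory in
/-- Directional derivatives of a holomorphic function of several variables are holomorphic. -/
theorem differentiableAt_fderiv_apply_of_differentiableOn {E : Type*} [NormedAddCommGroup E]
    [NormedSpace ℂ E] [FiniteDimensional ℂ E] {U : Set E} (hU : IsOpen U) {h : E → ℂ}
    (hh : DifferentiableOn ℂ h U) {x₀ : E} (hx₀ : x₀ ∈ U) (v : E) :
    DifferentiableAt ℂ (fun x => fderiv ℂ h x v) x₀ := by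
  borelize E
  obtain ⟨R, hR, hRU, hRh⟩ : ∃ R > 0, ball x₀ (3 * R) ⊆ U ∧
      ∀ y ∈ ball x₀ (3 * R), dist (h y) (h x₀) < 1 := by
    have h1 := hU.mem_nhds hx₀
    have h2 := (hh.continuousOn.continuousAt h1) (ball_mem_nhds (h x₀) one_pos)
    obtain ⟨ε, hε, hsub⟩ := Metric.mem_nhds_iff.1 (Filter.inter_mem h1 h2)
    refine ⟨ε / 3, by positivity, fun y hy => ?_, fun y hy => ?_⟩ <;>
      rw [mul_div_cancel₀ _ (by norm_num : (3 : ℝ) ≠ 0)] at hy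
    exacts [(hsub hy).1, (hsub hy).2]
  have hdiff : ∀ y ∈ ball x₀ (3 * R), DifferentiableAt ℂ h y := fun y hy =>
    hh.differentiableAt (hU.mem_nhds (hRU hy))
  have hbound : ∀ y ∈ ball x₀ (2 * R), ‖fderiv ℂ h y‖ ≤ 2 / R := by
    intro y hy
    have hsub : ball y R ⊆ ball x₀ (3 * R) :=
      ball_subset_ball' (by rw [mem_ball] at hy; linarith)
    refine Complex.norm_fderiv_le_div_of_mapsTo_ball
      (hh.mono (hsub.trans hRU)) (fun z hz => ?_) hR
    rw [mem_closedBall]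
    have h1 := hRh z (hsub hz)
    have h2 := hRh y (hsub (mem_ball_self hR))
    linarith [dist_triangle_right (h z) (h y) (h x₀)]
  have hlip : ∀ y ∈ ball x₀ (2 * R), ∀ z ∈ ball x₀ (2 * R),
      ‖h z - h y‖ ≤ 2 / R * ‖z - y‖ := fun y hy z hz =>
    (convex_ball x₀ (2 * R)).norm_image_sub_le_of_norm_fderiv_le (𝕜 := ℂ)
      (fun y hy => hdiff y (ball_subset_ball (by linarith) hy)) hbound hy hz
  obtain ⟨r, hr, hrv⟩ : ∃ r > 0, r * ‖v‖ < R := by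
    refine ⟨R / (‖v‖ + 1), by positivity, ?_⟩
    rw [div_mul_eq_mul_div, div_lt_iff₀ (by positivity)]
    nlinarith
  have hmem : ∀ x ∈ ball x₀ R, ∀ z : ℂ, ‖z‖ ≤ r → x + z • v ∈ ball x₀ (2 * R) := by
    intro x hx z hz
    rw [mem_ball, dist_eq_norm] at hx ⊢
    have h1 : ‖z • v‖ ≤ r * ‖v‖ := by rw [norm_smul]; gcongr
    calc ‖x + z • v - x₀‖ = ‖(x - x₀) + z • v‖ := by congr 1; abel
      _ ≤ ‖x - x₀‖ + ‖z • v‖ := norm_add_le _ _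
      _ < 2 * R := by linarith
  have hmemθ : ∀ x ∈ ball x₀ R, ∀ θ : ℝ, x + circleMap 0 r θ • v ∈ ball x₀ (2 * R) :=
    fun x hx θ => hmem x hx _ (by simp [abs_of_pos hr])
  set c : ℝ → ℂ := fun θ => deriv (circleMap 0 r) θ * ((circleMap 0 r θ - 0) ^ 2)⁻¹ with hc
  have hcc : Continuous c := by
    simp only [hc, deriv_circleMap, sub_zero]
    refine ((continuous_circleMap 0 r).mul continuous_const).mul
      (((continuous_circleMap 0 r).pow 2).inv₀ fun θ => ?_)
    exact pow_ne_zero 2 (circleMap_ne_center hr.ne')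
  have hcauchy : ∀ x ∈ ball x₀ R, fderiv ℂ h x v =
      (2 * Real.pi * Complex.I : ℂ)⁻¹ •
        ∫ θ in (0 : ℝ)..2 * Real.pi, c θ * h (x + circleMap 0 r θ • v) := by
    intro x hx
    have hline : ∀ z : ℂ, HasDerivAt (fun z : ℂ => x + z • v) v z := fun z => by
      simpa using ((hasDerivAt_id z).smul_const v).const_add x
    have hopen : IsOpen ((fun z : ℂ => x + z • v) ⁻¹' ball x₀ (3 * R)) :=
      isOpen_ball.preimage (by fun_prop)
    have key := Complex.two_pi_I_inv_smul_circleIntegral_sub_sq_inv_smul_of_differentiable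
      (f := fun z : ℂ => h (x + z • v)) (c := 0) (w₀ := 0) (R := r) hopen
      (fun z hz => ball_subset_ball (by linarith) (hmem x hx z (by simpa using hz)))
      (fun z hz => ((hdiff _ hz).comp z (hline z).differentiableAt).differentiableWithinAt)
      (mem_ball_self hr)
    have hx' : x + (0 : ℂ) • v ∈ ball x₀ (3 * R) := by
      simpa using ball_subset_ball (by linarith) hx
    have hd : deriv (fun z : ℂ => h (x + z • v)) 0 = fderiv ℂ h x v := by
      simpa [Function.comp_def] using ((hdiff _ hx').hasFDerivAt.comp_hasDerivAt (0 : ℂ) (hline 0)).deriv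
    rw [← hd, ← key, circleIntegral]
    simp only [hc, smul_eq_mul, mul_assoc]
  have hcont : ∀ x ∈ ball x₀ R, Continuous fun θ : ℝ => c θ * h (x + circleMap 0 r θ • v) := by
    intro x hx
    refine hcc.mul (continuous_iff_continuousAt.2 fun θ => ?_)
    exact ContinuousAt.comp (f := fun θ : ℝ => x + circleMap 0 r θ • v)
      (hdiff _ (ball_subset_ball (by linarith) (hmemθ x hx θ))).continuousAt
      (by have := continuous_circleMap 0 r; fun_prop)
  have hint := (intervalIntegral.hasFDerivAt_integral_of_dominated_loc_of_lip (𝕜 := ℂ)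
    (μ := volume) (a := 0) (b := 2 * Real.pi)
    (F := fun x θ => c θ * h (x + circleMap 0 r θ • v))
    (F' := fun θ => c θ • fderiv ℂ h (x₀ + circleMap 0 r θ • v))
    (bound := fun θ => ‖c θ‖ * (2 / R)) (ball_mem_nhds x₀ hR)
    (by
      filter_upwards [ball_mem_nhds x₀ hR] with x hx
      exact (hcont x hx).aestronglyMeasurable)
    ((hcont x₀ (mem_ball_self hR)).intervalIntegrable _ _)
    (by
      have hm : Measurable fun θ : ℝ => x₀ + circleMap 0 r θ • v := by
        have := continuous_circleMap 0 r
        exact Continuous.measurable (by fun_prop)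
      exact hcc.aestronglyMeasurable.smul
        ((measurable_fderiv ℂ h).comp hm).aestronglyMeasurable)
    (by
      refine Filter.Eventually.of_forall fun θ _ => LipschitzOnWith.of_dist_le_mul ?_
      intro x hx y hy
      rw [dist_eq_norm, dist_eq_norm, ← mul_sub, norm_mul, Real.coe_nnabs,
        abs_of_nonneg (by positivity), mul_assoc]
      gcongr
      simpa using hlip _ (hmemθ y hy θ) _ (hmemθ x hx θ))
    ((hcc.norm.mul continuous_const).intervalIntegrable _ _)
    (by
      refine Filter.Eventually.of_forall fun θ _ => ?_
      have h1 := (hdiff _ (ball_subset_ball (by linarith)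
        (hmemθ x₀ (mem_ball_self hR) θ))).hasFDerivAt
      exact ((hasFDerivAt_comp_add_right _).2 h1).const_mul (c θ))).2
  refine (hint.differentiableAt.const_smul
    ((2 * Real.pi * Complex.I : ℂ)⁻¹)).congr_of_eventuallyEq ?_
  filter_upwards [ball_mem_nhds x₀ hR] with x hx using hcauchy x hx

/-- The derivative of a holomorphic function of several variables is holomorphic. -/
theorem differentiableAt_fderiv_of_differentiableOn {E : Type*} [NormedAddCommGroup E]
    [NormedSpace ℂ E] [FiniteDimensional ℂ E] {U : Set E} (hU : IsOpen U) {h : E → ℂ}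
    (hh : DifferentiableOn ℂ h U) {x : E} (hx : x ∈ U) :
    DifferentiableAt ℂ (fderiv ℂ h) x := by
  let e₁ := ContinuousLinearEquiv.ofFinrankEq
    (Module.finrank_fin_fun ℂ (n := Module.finrank ℂ E)).symm
  let e₂ := (e₁.arrowCongr (1 : ℂ ≃L[ℂ] ℂ)).trans (ContinuousLinearEquiv.piRing (Fin _))
  rw [← e₂.comp_differentiableAt_iff, differentiableAt_pi]
  exact fun i => differentiableAt_fderiv_apply_of_differentiableOn hU hh hx _

section PartialDerivatives

variable {n : ℕ} {U : Set (Fin n → ℂ)} {x : Fin n → ℂ}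

theorem differentiableAt_pd (hU : IsOpen U) {h : (Fin n → ℂ) → ℂ}
    (hh : DifferentiableOn ℂ h U) (hx : x ∈ U) (i : Fin n) :
    DifferentiableAt ℂ (pd i h) x :=
  differentiableAt_fderiv_apply_of_differentiableOn hU hh hx _

theorem pd_comm (hU : IsOpen U) {h : (Fin n → ℂ) → ℂ}
    (hh : DifferentiableOn ℂ h U) (hx : x ∈ U) (i j : Fin n) :
    pd i (pd j h) x = pd j (pd i h) x := by
  have hd := differentiableAt_fderiv_of_differentiableOn hU hh hx
  have hpd : ∀ i j, pd i (pd j h) x =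
      fderiv ℂ (fderiv ℂ h) x (Pi.single i 1) (Pi.single j 1) := fun i j => by
    have h1 : HasFDerivAt (pd j h) _ x := hd.hasFDerivAt.clm_apply (hasFDerivAt_const _ x)
    simp [pd, h1.fderiv]
  rw [hpd, hpd]
  refine second_derivative_symmetric_of_eventually (𝕜 := ℂ) (f := h) ?_ hd.hasFDerivAt _ _
  filter_upwards [hU.mem_nhds hx] with y hy
  exact (hh.differentiableAt (hU.mem_nhds hy)).hasFDerivAt

theorem pd_add {h k : (Fin n → ℂ) → ℂ} (hh : DifferentiableAt ℂ h x)
    (hk : DifferentiableAt ℂ k x) (i : Fin n) :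
    pd i (fun y => h y + k y) x = pd i h x + pd i k x := by
  simp [pd, fderiv_fun_add hh hk]

theorem pd_sub {h k : (Fin n → ℂ) → ℂ} (hh : DifferentiableAt ℂ h x)
    (hk : DifferentiableAt ℂ k x) (i : Fin n) :
    pd i (fun y => h y - k y) x = pd i h x - pd i k x := by
  simp [pd, fderiv_fun_sub hh hk]

theorem pd_mul {h k : (Fin n → ℂ) → ℂ} (hh : DifferentiableAt ℂ h x)
    (hk : DifferentiableAt ℂ k x) (i : Fin n) :
    pd i (fun y => h y * k y) x = pd i h x * k x + h x * pd i k x := by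
  simp [pd, fderiv_fun_mul hh hk]
  ring

theorem pd_div {h k : (Fin n → ℂ) → ℂ} (hh : DifferentiableAt ℂ h x)
    (hk : DifferentiableAt ℂ k x) (hk0 : k x ≠ 0) (i : Fin n) :
    pd i (fun y => h y / k y) x = (pd i h x * k x - h x * pd i k x) / k x ^ 2 := by
  have h1 : HasFDerivAt (fun y => (k y)⁻¹) _ x :=
    (hasDerivAt_inv hk0).comp_hasFDerivAt x hk.hasFDerivAt
  have h2 : pd i (fun y => (k y)⁻¹) x = -(k x ^ 2)⁻¹ * pd i k x := by
    rw [pd, h1.fderiv]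
    simp [pd]
  simp only [div_eq_mul_inv]
  rw [pd_mul hh h1.differentiableAt, h2]
  field_simp
  ring

theorem pd_sum {ι : Type*} (s : Finset ι) {h : ι → (Fin n → ℂ) → ℂ}
    (hh : ∀ k ∈ s, DifferentiableAt ℂ (h k) x) (i : Fin n) :
    pd i (fun y => ∑ k ∈ s, h k y) x = ∑ k ∈ s, pd i (h k) x := by
  simp [pd, fderiv_fun_sum hh]

/-- The chain rule in terms of partial derivatives. -/
theorem pd_comp {Γ : (Fin n → ℂ) → (Fin n → ℂ)} {h : (Fin n → ℂ) → ℂ}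
    (hh : DifferentiableAt ℂ h (Γ x)) (hΓ : DifferentiableAt ℂ Γ x) (i : Fin n) :
    pd i (fun y => h (Γ y)) x = ∑ l, pd l h (Γ x) * pd i (fun y => Γ y l) x := by
  have h1 : HasFDerivAt (fun y => h (Γ y)) _ x := hh.hasFDerivAt.comp x hΓ.hasFDerivAt
  have h2 : ∀ l, pd i (fun y => Γ y l) x = fderiv ℂ Γ x (Pi.single i 1) l := fun l => by
    rw [pd, ((hasFDerivAt_pi'.1 hΓ.hasFDerivAt) l).fderiv]
    simp
  simp only [h2]
  rw [pd, h1.fderiv, ContinuousLinearMap.comp_apply]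
  conv_lhs => rw [pi_eq_sum_univ' (fderiv ℂ Γ x (Pi.single i 1)), map_sum]
  refine Finset.sum_congr rfl fun l _ => ?_
  rw [map_smul, smul_eq_mul, mul_comm, pd]

/-- The exterior derivative commutes with pullback of 1-forms. -/
theorem pd_pullback1_sub_pd_pullback1 (hU : IsOpen U) {Γ : (Fin n → ℂ) → (Fin n → ℂ)}
    (hΓ : DifferentiableOn ℂ Γ U) {h : Fin n → (Fin n → ℂ) → ℂ} (hx : x ∈ U)
    (hh : ∀ k, DifferentiableAt ℂ (h k) (Γ x)) (i j : Fin n) :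
    pd i (pullback1 Γ h j) x - pd j (pullback1 Γ h i) x =
      ∑ k, ∑ l, (pd l (h k) (Γ x) - pd k (h l) (Γ x)) *
        (pd i (fun y => Γ y l) x * pd j (fun y => Γ y k) x) := by
  have hΓx : DifferentiableAt ℂ Γ x := hΓ.differentiableAt (hU.mem_nhds hx)
  have hΓk : ∀ k, DifferentiableOn ℂ (fun y => Γ y k) U := differentiableOn_pi.1 hΓ
  have hcomp : ∀ k, DifferentiableAt ℂ (fun y => h k (Γ y)) x := fun k => (hh k).comp x hΓx
  have hpd : ∀ i j, pd i (pullback1 Γ h j) x =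
      (∑ k, ∑ l, pd l (h k) (Γ x) * (pd i (fun y => Γ y l) x * pd j (fun y => Γ y k) x)) +
        ∑ k, h k (Γ x) * pd i (pd j (fun y => Γ y k)) x := by
    intro i j
    have h1 : ∀ k, DifferentiableAt ℂ (pd j (fun y => Γ y k)) x := fun k =>
      differentiableAt_pd hU (hΓk k) hx j
    rw [show pullback1 Γ h j = fun y => ∑ k, h k (Γ y) * pd j (fun y => Γ y k) y from rfl,
      pd_sum _ (fun k _ => (hcomp k).fun_mul (h1 k)), ← Finset.sum_add_distrib]
    refine Finset.sum_congr rfl fun k _ => ?_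
    rw [pd_mul (hcomp k) (h1 k), pd_comp (hh k) hΓx, Finset.sum_mul]
    simp only [mul_assoc]
  simp only [hpd, pd_comm hU (hΓk _) hx i j, add_sub_add_right_eq_sub, sub_mul,
    Finset.sum_sub_distrib]
  congr 1
  rw [Finset.sum_comm]
  simp only [mul_comm (pd j _ x)]

end PartialDerivatives

/-- If `dω = ω ∧ α`, `dα = ω ∧ β`, `Γ*ω = f·ω` with `f` nowhere
vanishing, and `Γ*α − α + df/f = g·ω`, then the 1-form
`f·Γ*β − β − g·α + dg` is proportional to `ω`. -/
theorem pullback_beta_proportional_omega {n : ℕ}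
    (U : Set (Fin n → ℂ)) (hU : IsOpen U)
    (w α β : Fin n → (Fin n → ℂ) → ℂ)
    (hw : ∀ i, DifferentiableOn ℂ (w i) U)
    (hα : ∀ i, DifferentiableOn ℂ (α i) U)
    (hβ : ∀ i, DifferentiableOn ℂ (β i) U)
    (hGV1 : ∀ i j, ∀ x ∈ U,
      pd i (w j) x - pd j (w i) x = w i x * α j x - w j x * α i x)
    (hGV2 : ∀ i j, ∀ x ∈ U,
      pd i (α j) x - pd j (α i) x = w i x * β j x - w j x * β i x)
    (Γ : (Fin n → ℂ) → (Fin n → ℂ))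
    (hΓ : DifferentiableOn ℂ Γ U) (hΓmaps : Set.MapsTo Γ U U)
    (f : (Fin n → ℂ) → ℂ)
    (hf : DifferentiableOn ℂ f U) (hf0 : ∀ x ∈ U, f x ≠ 0)
    (hpullω : ∀ i, ∀ x ∈ U, pullback1 Γ w i x = f x * w i x)
    (g : (Fin n → ℂ) → ℂ) (hg : DifferentiableOn ℂ g U)
    (hpullα : ∀ i, ∀ x ∈ U,
      pullback1 Γ α i x - α i x + pd i f x / f x = g x * w i x) :
    ∀ i j, ∀ x ∈ U,
      (f x * pullback1 Γ β i x - β i x - g x * α i x + pd i g x) * w j x =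
      (f x * pullback1 Γ β j x - β j x - g x * α j x + pd j g x) * w i x := by
  intro i j x hx
  have hnhds : ∀ {y}, y ∈ U → U ∈ nhds y := fun hy => hU.mem_nhds hy
  have hwx : ∀ k, DifferentiableAt ℂ (w k) x := fun k => (hw k).differentiableAt (hnhds hx)
  have hαx : ∀ k, DifferentiableAt ℂ (α k) x := fun k => (hα k).differentiableAt (hnhds hx)
  have hfx : DifferentiableAt ℂ f x := hf.differentiableAt (hnhds hx)
  have hgx : DifferentiableAt ℂ g x := hg.differentiableAt (hnhds hx)
  have hleft : pd i (pullback1 Γ α j) x - pd j (pullback1 Γ α i) x =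
      f x * w i x * pullback1 Γ β j x - f x * w j x * pullback1 Γ β i x := by
    rw [pd_pullback1_sub_pd_pullback1 hU hΓ hx
      (fun k => (hα k).differentiableAt (hnhds (hΓmaps hx))), ← hpullω i x hx, ← hpullω j x hx]
    simp only [hGV2 _ _ _ (hΓmaps hx), pullback1, Finset.sum_mul_sum]
    rw [Finset.sum_comm (f := fun a b => w a (Γ x) * pd i (fun y => Γ y a) x * _),
      ← Finset.sum_sub_distrib]
    refine Finset.sum_congr rfl fun k _ => ?_
    rw [← Finset.sum_sub_distrib]
    exact Finset.sum_congr rfl fun l _ => by ring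
  have hright : ∀ i j, pd i (pullback1 Γ α j) x = pd i (α j) x -
      (pd i (pd j f) x * f x - pd j f x * pd i f x) / f x ^ 2 +
      (pd i g x * w j x + g x * pd i (w j) x) := by
    intro i j
    have hEq : pullback1 Γ α j =ᶠ[nhds x] fun y => α j y - pd j f y / f y + g y * w j y := by
      filter_upwards [hnhds hx] with y hy
      linear_combination hpullα j y hy
    have hpdf := differentiableAt_pd hU hf hx j
    have hdiv : DifferentiableAt ℂ (fun y => pd j f y / f y) x := by
      simpa only [div_eq_mul_inv] using hpdf.fun_mul (hfx.fun_inv (hf0 x hx))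
    rw [pd, hEq.fderiv_eq, ← pd, pd_add ((hαx j).fun_sub hdiv) (hgx.fun_mul (hwx j)),
      pd_sub (hαx j) hdiv, pd_div hpdf hfx (hf0 x hx), pd_mul hgx (hwx j)]
  rw [hright, hright, pd_comm hU hf hx i j] at hleft
  linear_combination hleft - hGV2 i j x hx - g x * hGV1 i j x hx
end

section
/- Let K be a Δ-field and ω = (w₁, w₂) ∈ K² with (w₁, w₂) ≠ (0, 0). The following are equivalent. (a) There exist a Δ-field extension E of K, a Liouvillian tower K = K₀ ⊆ K₁ ⊆ … ⊆ K_m = E of differential subfields, and an element H ∈ E with δ₁H·w₂ − δ₂H·w₁ = 0 and (δ₁H, δ₂H) ≠ (0, 0). (b) There exist A₁, A₂ ∈ K such that δ₁w₂ − δ₂w₁ = w₁·A₂ − w₂·A₁ and δ₁A₂ − δ₂A₁ = 0 (a closed 1-form α over K with dω = ω ∧ α: a Godbillon–Vey sequence of length two). -/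
open scoped BigOperators

/-- A Δ-field: a field of characteristic zero equipped with two commuting
derivations `d₁`, `d₂`. -/
structure DeltaField where
  carrier : Type
  [field : Field carrier]
  [charZero : CharZero carrier]
  d₁ : carrier → carrier
  d₂ : carrier → carrier
  d₁_add : ∀ x y, d₁ (x + y) = d₁ x + d₁ y
  d₁_mul : ∀ x y, d₁ (x * y) = d₁ x * y + x * d₁ y
  d₂_add : ∀ x y, d₂ (x + y) = d₂ x + d₂ y
  d₂_mul : ∀ x y, d₂ (x * y) = d₂ x * y + x * d₂ y
  comm : ∀ x, d₁ (d₂ x) = d₂ (d₁ x)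

attribute [instance] DeltaField.field DeltaField.charZero

/-- A differential subfield: a subfield closed under both derivations. -/
def DiffSubfield (E : DeltaField) (L : Subfield E.carrier) : Prop :=
  ∀ x ∈ L, E.d₁ x ∈ L ∧ E.d₂ x ∈ L

/-- `x` is algebraic over the subfield `L`: it satisfies a nonzero polynomial
relation with coefficients in `L`. -/
def AlgebraicOver (E : DeltaField) (L : Subfield E.carrier) (x : E.carrier) : Prop :=
  ∃ (k : ℕ) (c : Fin (k + 1) → E.carrier),
    (∀ j, c j ∈ L) ∧ (∃ j, c j ≠ 0) ∧ ∑ j, c j * x ^ (j : ℕ) = 0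

/-- An algebraic extension step `L ⊆ M`. -/
def AlgStep (E : DeltaField) (L M : Subfield E.carrier) : Prop :=
  ∀ x ∈ M, AlgebraicOver E L x

/-- A Liouvillian extension step: `M = L(G)` with `dⱼG = G·cⱼ + dⱼ` for some
`cⱼ, dⱼ ∈ L` (`j = 1, 2`). -/
def LiouvilleStep (E : DeltaField) (L M : Subfield E.carrier) : Prop :=
  ∃ (G c1 e1 c2 e2 : E.carrier), c1 ∈ L ∧ e1 ∈ L ∧ c2 ∈ L ∧ e2 ∈ L ∧
    E.d₁ G = G * c1 + e1 ∧ E.d₂ G = G * c2 + e2 ∧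
    M = Subfield.closure ((L : Set E.carrier) ∪ {G})

/-- A Liouvillian tower over `K₀` inside `E`: a chain of differential subfields
`K₀ = Ks 0 ⊆ … ⊆ Ks m = E` in which each step is either algebraic or Liouvillian. -/
def LiouvilleTower (E : DeltaField) (K₀ : Subfield E.carrier) : Prop :=
  ∃ (m : ℕ) (Ks : Fin (m + 1) → Subfield E.carrier),
    Ks 0 = K₀ ∧ Ks (Fin.last m) = ⊤ ∧
    (∀ i, DiffSubfield E (Ks i)) ∧
    (∀ i : Fin m, Ks i.castSucc ≤ Ks i.succ ∧
      (AlgStep E (Ks i.castSucc) (Ks i.succ) ∨ LiouvilleStep E (Ks i.castSucc) (Ks i.succ)))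

open Polynomial

namespace Derivation

section Trace

variable {L F : Type*} [Field L] [Field F] [Algebra L F] {d : Derivation ℤ L L}
  {D : Derivation ℤ F F}

/-- The coordinates of `D y` in a basis, for a derivation `D` extending `d`. -/
theorem repr_apply_of_extends (h : ∀ a, D (algebraMap L F a) = algebraMap L F (d a))
    {ι : Type*} [Fintype ι] (b : Module.Basis ι L F) (y : F) (i : ι) :
    b.repr (D y) i = d (b.repr y i) + ∑ k, b.repr (D (b k)) i * b.repr y k := by
  have hy : D y = ∑ k, (d (b.repr y k) • b k + b.repr y k • D (b k)) := by
    conv_lhs => rw [← b.sum_repr y, map_sum]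
    refine Finset.sum_congr rfl fun k _ ↦ ?_
    rw [Algebra.smul_def, D.leibniz, h, smul_eq_mul, smul_eq_mul, Algebra.smul_def,
      Algebra.smul_def, mul_comm (b k), add_comm]
  classical
  rw [hy]
  simp [Finset.sum_add_distrib, Finsupp.single_apply, mul_comm]

/-- The trace of a finite extension commutes with compatible derivations. -/
theorem trace_apply_of_extends [FiniteDimensional L F]
    (h : ∀ a, D (algebraMap L F a) = algebraMap L F (d a)) (x : F) :
    Algebra.trace L F (D x) = d (Algebra.trace L F x) := by
  classical
  let b := Module.finBasis L F
  let N : Matrix _ _ L := Matrix.of fun i j ↦ b.repr (D (b j)) i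
  have hM : Algebra.leftMulMatrix b (D x) =
      (Algebra.leftMulMatrix b x).map d + N * Algebra.leftMulMatrix b x
        - Algebra.leftMulMatrix b x * N := by
    ext i j
    have hx : D x * b j = D (x * b j) - x * D (b j) := by
      rw [D.leibniz]; simp only [smul_eq_mul]; ring
    have hN : (Algebra.leftMulMatrix b x * N) i j = b.repr (x * D (b j)) i := by
      rw [← Algebra.leftMulMatrix_mulVec_repr]; rfl
    rw [Matrix.sub_apply, hN, Algebra.leftMulMatrix_eq_repr_mul, hx, map_sub, Finsupp.sub_apply,
      repr_apply_of_extends h]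
    simp [Matrix.mul_apply, N, Algebra.leftMulMatrix_eq_repr_mul]
  rw [Algebra.trace_eq_matrix_trace b, Algebra.trace_eq_matrix_trace b, hM, Matrix.trace_sub,
    Matrix.trace_add, Matrix.trace_mul_comm N, add_sub_cancel_right]
  simp [Matrix.trace]

end Trace

/-- A derivation of `E` that preserves `L` preserves every algebraic intermediate field. -/
theorem apply_mem_of_isAlgebraic {L E : Type*} [Field L] [CharZero L] [Field E] [Algebra L E]
    {d : Derivation ℤ L L} {D : Derivation ℤ E E}
    (h : ∀ a, D (algebraMap L E a) = algebraMap L E (d a))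
    (F : IntermediateField L E) {x : E} (hx : x ∈ F) (hxa : IsAlgebraic L x) : D x ∈ F := by
  let : Differential L := ⟨d⟩
  let : Differential E := ⟨D⟩
  have : DifferentialAlgebra L E := ⟨h⟩
  have hF (p : L[X]) : aeval x p ∈ F :=
    (aeval_algebraMap_apply E (⟨x, hx⟩ : F) p) ▸ (aeval (⟨x, hx⟩ : F) p).2
  have hne : aeval x (derivative (minpoly L x)) ≠ 0 :=
    (minpoly.irreducible hxa.isIntegral).separable.aeval_derivative_ne_zero (minpoly.aeval L x)
  have h0 : D (aeval x (minpoly L x)) = aeval x (Differential.mapCoeffs (minpoly L x)) +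
      aeval x (derivative (minpoly L x)) * D x := Differential.deriv_aeval_eq x (minpoly L x)
  rw [minpoly.aeval, map_zero] at h0
  have hD : D x = -aeval x (Differential.mapCoeffs (minpoly L x)) /
      aeval x (derivative (minpoly L x)) := by
    rw [eq_div_iff hne]; linear_combination -h0
  rw [hD]
  exact F.div_mem (F.neg_mem (hF _)) (hF _)

/-- The restriction of a derivation to a subfield that it preserves. -/
def restrictSubfield {E S : Type*} [Field E] [SetLike S E] [SubfieldClass S E]
    (D : Derivation ℤ E E) (F : S) (hF : ∀ x ∈ F, D x ∈ F) : Derivation ℤ F F :=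
  Derivation.mk' (AddMonoidHom.mk' (fun x : F ↦ (⟨D x, hF x x.2⟩ : F))
    fun x y ↦ Subtype.ext (D.map_add x y)).toIntLinearMap
    fun x y ↦ Subtype.ext (D.leibniz x y)

end Derivation

/-- In dimension two, a form whose wedge with `ω ≠ 0` vanishes is a multiple of `ω`. -/
theorem exists_eq_mul_of_wedge_eq_zero {L : Type*} [Field L] {w₁ w₂ a₁ a₂ : L}
    (hne : ¬(w₁ = 0 ∧ w₂ = 0)) (h : a₁ * w₂ - a₂ * w₁ = 0) : ∃ f, a₁ = f * w₁ ∧ a₂ = f * w₂ := by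
  by_cases hw₁ : w₁ = 0
  · have hw₂ : w₂ ≠ 0 := fun h ↦ hne ⟨hw₁, h⟩
    refine ⟨a₂ / w₂, mul_left_cancel₀ hw₂ ?_, by field_simp⟩
    rw [hw₁] at h ⊢
    linear_combination h
  · refine ⟨a₁ / w₁, by field_simp, ?_⟩
    field_simp
    linear_combination -h

section Descent

variable {L E : Type*} [Field L] [Field E] [Algebra L E]
  {d₁ d₂ : Derivation ℤ L L} {D₁ D₂ : Derivation ℤ E E}

/-- If `f • ω` is closed up to a closed form `c`, then `df / f + c` is a closed form `β`
with `dω = ω ∧ β`. -/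
theorem exists_closed_form_of_integrating_factor (hd : ∀ a, d₁ (d₂ a) = d₂ (d₁ a))
    {f w₁ w₂ c₁ c₂ : L} (hf : f ≠ 0) (hc : d₁ c₂ = d₂ c₁)
    (h : d₁ (f * w₂) + c₁ * (f * w₂) = d₂ (f * w₁) + c₂ * (f * w₁)) :
    ∃ B₁ B₂ : L, d₁ w₂ - d₂ w₁ = w₁ * B₂ - w₂ * B₁ ∧ d₁ B₂ - d₂ B₁ = 0 := by
  refine ⟨d₁ f / f + c₁, d₂ f / f + c₂, ?_, ?_⟩
  · simp only [Derivation.leibniz, smul_eq_mul] at h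
    field_simp
    linear_combination h
  · simp only [map_add, Derivation.leibniz_div, smul_eq_mul]
    linear_combination hc + f⁻¹ ^ 2 * f * hd f

/-- A closed form `α` with `u = ω ∧ α` descends along an algebraic extension, by averaging the
trace. -/
theorem exists_closed_form_of_isAlgebraic [CharZero L]
    (h₁ : ∀ a, D₁ (algebraMap L E a) = algebraMap L E (d₁ a))
    (h₂ : ∀ a, D₂ (algebraMap L E a) = algebraMap L E (d₂ a))
    {u w₁ w₂ : L} {A₁ A₂ : E} (hA₁ : IsAlgebraic L A₁) (hA₂ : IsAlgebraic L A₂)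
    (hw : algebraMap L E u = algebraMap L E w₁ * A₂ - algebraMap L E w₂ * A₁)
    (hA : D₁ A₂ - D₂ A₁ = 0) :
    ∃ B₁ B₂ : L, u = w₁ * B₂ - w₂ * B₁ ∧ d₁ B₂ - d₂ B₁ = 0 := by
  let F := IntermediateField.adjoin L {A₁, A₂}
  have hi : ∀ x ∈ ({A₁, A₂} : Set E), IsIntegral L x := by
    rintro x (rfl | rfl)
    exacts [hA₁.isIntegral, hA₂.isIntegral]
  have : FiniteDimensional L F :=
    IntermediateField.finiteDimensional_adjoin hi
  have hF (D : Derivation ℤ E E) (d : Derivation ℤ L L)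
      (h : ∀ a, D (algebraMap L E a) = algebraMap L E (d a)) : ∀ x ∈ F, D x ∈ F := fun x hx ↦
    Derivation.apply_mem_of_isAlgebraic h F hx
      (IntermediateField.isAlgebraic_iff.1 (Algebra.IsAlgebraic.isAlgebraic (⟨x, hx⟩ : F)))
  let D₁' := D₁.restrictSubfield F (hF D₁ d₁ h₁)
  let D₂' := D₂.restrictSubfield F (hF D₂ d₂ h₂)
  have h₁' : ∀ a, D₁' (algebraMap L F a) = algebraMap L F (d₁ a) := fun a ↦ Subtype.ext (h₁ a)
  have h₂' : ∀ a, D₂' (algebraMap L F a) = algebraMap L F (d₂ a) := fun a ↦ Subtype.ext (h₂ a)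
  let a₁ : F := ⟨A₁, IntermediateField.subset_adjoin L _ (by simp)⟩
  let a₂ : F := ⟨A₂, IntermediateField.subset_adjoin L _ (by simp)⟩
  have hw' : algebraMap L F u = w₁ • a₂ - w₂ • a₁ := by
    apply Subtype.ext
    simpa [Algebra.smul_def] using hw
  have hA' : D₁' a₂ - D₂' a₁ = 0 := Subtype.ext hA
  have hn : (Module.finrank L F : L) ≠ 0 :=
    Nat.cast_ne_zero.2 Module.finrank_pos.ne'
  have ht := congrArg (Algebra.trace L F) hw'
  have htA := congrArg (Algebra.trace L F) hA'
  rw [Algebra.trace_algebraMap, map_sub, map_smul, map_smul, smul_eq_mul, smul_eq_mul,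
    nsmul_eq_mul] at ht
  rw [map_sub, map_zero, Derivation.trace_apply_of_extends h₁',
    Derivation.trace_apply_of_extends h₂'] at htA
  refine ⟨Algebra.trace L F a₁ / Module.finrank L F, Algebra.trace L F a₂ / Module.finrank L F,
    ?_, ?_⟩
  · field_simp
    linear_combination ht
  · rw [Derivation.leibniz_div_const _ _ _ (d₁.map_natCast _),
      Derivation.leibniz_div_const _ _ _ (d₂.map_natCast _), ← smul_sub, htA, smul_zero]

/-- The derivation of `L[X]` extending `d` with `X ↦ c * X + e`. -/
noncomputable def affineDeriv (d : Derivation ℤ L L) (c e : L) : Derivation ℤ L[X] L[X] :=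
  letI : Differential L := ⟨d⟩
  Differential.implicitDeriv (C c * X + C e)

theorem affineDeriv_C (d : Derivation ℤ L L) (c e a : L) : affineDeriv d c e (C a) = C (d a) :=
  let : Differential L := ⟨d⟩
  Differential.implicitDeriv_C _ a

theorem affineDeriv_X (d : Derivation ℤ L L) (c e : L) : affineDeriv d c e X = C c * X + C e :=
  let : Differential L := ⟨d⟩
  Differential.implicitDeriv_X _

theorem aeval_affineDeriv {d : Derivation ℤ L L} {D : Derivation ℤ E E}
    (h : ∀ a, D (algebraMap L E a) = algebraMap L E (d a)) {G : E} {c e : L}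
    (hG : D G = G * algebraMap L E c + algebraMap L E e) (p : L[X]) :
    D (aeval G p) = aeval G (affineDeriv d c e p) := by
  let : Differential L := ⟨d⟩
  let : Differential E := ⟨D⟩
  have : DifferentialAlgebra L E := ⟨h⟩
  refine Differential.deriv_aeval_eq_implicitDeriv G (C c * X + C e) ?_ p
  change D G = _
  rw [hG, map_add, map_mul, aeval_C, aeval_C, aeval_X, mul_comm G]

theorem coeff_affineDeriv (d : Derivation ℤ L L) (c e : L) (p : L[X]) (n : ℕ) :
    (affineDeriv d c e p).coeff n =
      d (p.coeff n) + n * c * p.coeff n + (n + 1) * e * p.coeff (n + 1) := by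
  let : Differential L := ⟨d⟩
  have : affineDeriv d c e p = Differential.mapCoeffs p + (C c * X + C e) * derivative p := rfl
  rw [this, coeff_add, Differential.coeff_mapCoeffs, add_mul, coeff_add, mul_assoc, coeff_C_mul,
    coeff_C_mul]
  change d _ + _ = _
  cases n with
  | zero => simp [coeff_derivative, mul_comm]
  | succ n => simp [coeff_derivative]; ring

theorem natDegree_affineDeriv_le {d : Derivation ℤ L L} {c e : L} {p : L[X]} {n : ℕ}
    (hp : p.natDegree ≤ n) : (affineDeriv d c e p).natDegree ≤ n := by
  rw [natDegree_le_iff_coeff_eq_zero] at hp ⊢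
  intro m hm
  simp [coeff_affineDeriv, hp m hm, hp (m + 1) (by omega)]

theorem coeff_affineDeriv_of_natDegree_le {d : Derivation ℤ L L} {c e : L} {p : L[X]} {n : ℕ}
    (hp : p.natDegree ≤ n) :
    (affineDeriv d c e p).coeff n = d (p.coeff n) + n * c * p.coeff n := by
  rw [coeff_affineDeriv, coeff_eq_zero_of_natDegree_lt (Nat.lt_succ_of_le hp)]
  ring

/-- Two elements of `L(G)` have a common monic denominator. -/
theorem exists_monic_common_denominator {G A₁ A₂ : E}
    (hA₁ : A₁ ∈ IntermediateField.adjoin L {G}) (hA₂ : A₂ ∈ IntermediateField.adjoin L {G}) :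
    ∃ P₁ P₂ Q : L[X], Q.Monic ∧ A₁ * aeval G Q = aeval G P₁ ∧ A₂ * aeval G Q = aeval G P₂ := by
  have key {A : E} (hA : A ∈ IntermediateField.adjoin L {G}) :
      ∃ P Q : L[X], Q.Monic ∧ A * aeval G Q = aeval G P := by
    obtain ⟨r, s, rfl⟩ := (IntermediateField.mem_adjoin_simple_iff L _).1 hA
    by_cases hs : aeval G s = 0
    · exact ⟨0, 1, monic_one, by simp [hs]⟩
    · have hs0 : s ≠ 0 := by rintro rfl; simp at hs
      refine ⟨r * C s.leadingCoeff⁻¹, s * C s.leadingCoeff⁻¹, monic_mul_leadingCoeff_inv hs0, ?_⟩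
      rw [map_mul, map_mul]
      field_simp
  obtain ⟨P₁, Q₁, hQ₁, h₁⟩ := key hA₁
  obtain ⟨P₂, Q₂, hQ₂, h₂⟩ := key hA₂
  refine ⟨P₁ * Q₂, P₂ * Q₁, Q₁ * Q₂, hQ₁.mul hQ₂, ?_, ?_⟩
  · rw [map_mul, map_mul, ← h₁]; ring
  · rw [map_mul, map_mul, ← h₂]; ring

/-- If `G` is transcendental and `Dⱼ G = G * cⱼ + eⱼ`, then the form `(c₁, c₂)` is closed. -/
theorem closed_of_transcendental
    (h₁ : ∀ a, D₁ (algebraMap L E a) = algebraMap L E (d₁ a))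
    (h₂ : ∀ a, D₂ (algebraMap L E a) = algebraMap L E (d₂ a))
    {G : E} (hG : Transcendental L G) (hcomm : D₁ (D₂ G) = D₂ (D₁ G)) {c₁ e₁ c₂ e₂ : L}
    (hG₁ : D₁ G = G * algebraMap L E c₁ + algebraMap L E e₁)
    (hG₂ : D₂ G = G * algebraMap L E c₂ + algebraMap L E e₂) :
    d₁ c₂ = d₂ c₁ := by
  rw [hG₁, hG₂, map_add, map_add, D₁.leibniz, D₂.leibniz, h₁, h₁, h₂, h₂, hG₁, hG₂] at hcomm
  have : aeval G (C (d₁ c₂ - d₂ c₁) * X + C (c₂ * e₁ + d₁ e₂ - (c₁ * e₂ + d₂ e₁))) = 0 := by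
    simp only [map_add, map_mul, map_sub, aeval_C, aeval_X]
    simp only [smul_eq_mul] at hcomm
    linear_combination hcomm
  have h0 := (transcendental_iff.1 hG) _ this
  have := congrArg (coeff · 1) h0
  simpa [coeff_C, sub_eq_zero] using this

/-- A closed form `α` with `dω = ω ∧ α` descends from `L(G)` to `L`, by taking the leading
coefficient of its expansion at `G = ∞`. -/
theorem exists_closed_form_of_transcendental
    (h₁ : ∀ a, D₁ (algebraMap L E a) = algebraMap L E (d₁ a))
    (h₂ : ∀ a, D₂ (algebraMap L E a) = algebraMap L E (d₂ a))
    (hd : ∀ a, d₁ (d₂ a) = d₂ (d₁ a))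
    {G : E} (hG : Transcendental L G) (hcomm : D₁ (D₂ G) = D₂ (D₁ G)) {c₁ e₁ c₂ e₂ : L}
    (hG₁ : D₁ G = G * algebraMap L E c₁ + algebraMap L E e₁)
    (hG₂ : D₂ G = G * algebraMap L E c₂ + algebraMap L E e₂)
    {w₁ w₂ : L} (hne : ¬(w₁ = 0 ∧ w₂ = 0)) {A₁ A₂ : E}
    (hA₁ : A₁ ∈ IntermediateField.adjoin L {G}) (hA₂ : A₂ ∈ IntermediateField.adjoin L {G})
    (hw : algebraMap L E (d₁ w₂ - d₂ w₁) = algebraMap L E w₁ * A₂ - algebraMap L E w₂ * A₁)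
    (hA : D₁ A₂ - D₂ A₁ = 0) :
    ∃ B₁ B₂ : L, d₁ w₂ - d₂ w₁ = w₁ * B₂ - w₂ * B₁ ∧ d₁ B₂ - d₂ B₁ = 0 := by
  obtain ⟨P₁, P₂, Q, hQ, hP₁, hP₂⟩ := exists_monic_common_denominator hA₁ hA₂
  have hc := closed_of_transcendental h₁ h₂ hG hcomm hG₁ hG₂
  have hinj {p q : L[X]} (h : aeval G p = aeval G q) : p = q := by
    rw [← sub_eq_zero] at h ⊢
    exact transcendental_iff.1 hG _ (by rw [map_sub, h])
  set T₁ := affineDeriv d₁ c₁ e₁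
  set T₂ := affineDeriv d₂ c₂ e₂
  have hwP : C (d₁ w₂ - d₂ w₁) * Q = C w₁ * P₂ - C w₂ * P₁ := by
    apply hinj
    simp only [map_sub, map_mul, aeval_C, ← hP₁, ← hP₂] at hw ⊢
    linear_combination aeval G Q * hw
  have hAP : T₁ P₂ * Q - P₂ * T₁ Q = T₂ P₁ * Q - P₁ * T₂ Q := by
    apply hinj
    simp only [map_sub, map_mul, T₁, T₂, ← aeval_affineDeriv h₁ hG₁, ← aeval_affineDeriv h₂ hG₂,
      ← hP₁, ← hP₂, Derivation.leibniz, smul_eq_mul]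
    linear_combination aeval G Q ^ 2 * hA
  obtain ⟨N, hN₁, hN₂, hN⟩ : ∃ N, P₁.natDegree ≤ Q.natDegree + N ∧
      P₂.natDegree ≤ Q.natDegree + N ∧
      (N = 0 ∨ ¬(P₁.coeff (Q.natDegree + N) = 0 ∧ P₂.coeff (Q.natDegree + N) = 0)) := by
    refine ⟨max P₁.natDegree P₂.natDegree - Q.natDegree, by omega, by omega, ?_⟩
    rw [or_iff_not_imp_left]
    intro h0 ⟨hz₁, hz₂⟩
    rw [show Q.natDegree + (max P₁.natDegree P₂.natDegree - Q.natDegree) =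
      max P₁.natDegree P₂.natDegree by omega] at hz₁ hz₂
    rcases le_total P₁.natDegree P₂.natDegree with h | h
    · rw [max_eq_right h, coeff_natDegree, leadingCoeff_eq_zero] at hz₂
      simp [hz₂] at h0 h
      omega
    · rw [max_eq_left h, coeff_natDegree, leadingCoeff_eq_zero] at hz₁
      simp [hz₁] at h0 h
      omega
  set q := Q.natDegree
  set a₁ := P₁.coeff (q + N)
  set a₂ := P₂.coeff (q + N)
  have hQq : Q.coeff q = 1 := hQ
  have hclosed : d₁ a₂ + N * c₁ * a₂ = d₂ a₁ + N * c₂ * a₁ := by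
    have := congrArg (coeff · (q + N + q)) hAP
    simp only [coeff_sub] at this
    rw [coeff_mul_add_eq_of_natDegree_le (natDegree_affineDeriv_le hN₂) le_rfl,
      coeff_mul_add_eq_of_natDegree_le (natDegree_affineDeriv_le hN₁) le_rfl,
      coeff_mul_add_eq_of_natDegree_le hN₂ (natDegree_affineDeriv_le le_rfl),
      coeff_mul_add_eq_of_natDegree_le hN₁ (natDegree_affineDeriv_le le_rfl),
      coeff_affineDeriv_of_natDegree_le hN₁, coeff_affineDeriv_of_natDegree_le hN₂,
      coeff_affineDeriv_of_natDegree_le le_rfl, coeff_affineDeriv_of_natDegree_le le_rfl,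
      hQq, d₁.map_one_eq_zero, d₂.map_one_eq_zero] at this
    push_cast at this
    linear_combination this
  have hwa := congrArg (coeff · (q + N)) hwP
  simp only [coeff_sub, coeff_C_mul] at hwa
  by_cases hN0 : N = 0
  · subst hN0
    refine ⟨a₁, a₂, ?_, ?_⟩
    · rwa [add_zero, hQq, mul_one] at hwa
    · simpa [sub_eq_zero] using hclosed
  · rw [coeff_eq_zero_of_natDegree_lt (show q < q + N by omega), mul_zero] at hwa
    obtain ⟨f, hf₁, hf₂⟩ := exists_eq_mul_of_wedge_eq_zero (a₁ := a₁) (a₂ := a₂) hne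
      (by linear_combination hwa)
    have hf : f ≠ 0 := by
      rintro rfl
      exact hN.resolve_left hN0 ⟨by rw [hf₁, zero_mul], by rw [hf₂, zero_mul]⟩
    refine exists_closed_form_of_integrating_factor hd hf (c₁ := N * c₁) (c₂ := N * c₂) ?_ ?_
    · simp [hc]
    · rw [← hf₁, ← hf₂]
      exact hclosed

end Descent
namespace DeltaField

/-- The first derivation of a Δ-field, bundled. -/
def der₁ (E : DeltaField) : Derivation ℤ E.carrier E.carrier :=
  Derivation.mk' (AddMonoidHom.mk' E.d₁ E.d₁_add).toIntLinearMap fun x y ↦ by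
    change E.d₁ (x * y) = x * E.d₁ y + y * E.d₁ x
    rw [E.d₁_mul]; ring

/-- The second derivation of a Δ-field, bundled. -/
def der₂ (E : DeltaField) : Derivation ℤ E.carrier E.carrier :=
  Derivation.mk' (AddMonoidHom.mk' E.d₂ E.d₂_add).toIntLinearMap fun x y ↦ by
    change E.d₂ (x * y) = x * E.d₂ y + y * E.d₂ x
    rw [E.d₂_mul]; ring

/-- The form `(w₁, w₂)` admits a Godbillon-Vey sequence of length two over the subfield `L`. -/
def HasClosedForm (E : DeltaField) (w₁ w₂ : E.carrier) (L : Subfield E.carrier) : Prop :=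
  ∃ A₁ ∈ L, ∃ A₂ ∈ L, E.d₁ w₂ - E.d₂ w₁ = w₁ * A₂ - w₂ * A₁ ∧ E.d₁ A₂ - E.d₂ A₁ = 0

variable {E : DeltaField} {L M : Subfield E.carrier} {w₁ w₂ : E.carrier}

theorem isAlgebraic_of_algebraicOver {x : E.carrier} (h : AlgebraicOver E L x) :
    IsAlgebraic L x := by
  obtain ⟨k, c, hc, ⟨j, hj⟩, hx⟩ := h
  refine ⟨∑ i : Fin (k + 1), monomial (i : ℕ) (⟨c i, hc i⟩ : L), fun h0 ↦ hj ?_, ?_⟩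
  · have := congrArg (coeff · (j : ℕ)) h0
    simp only [finsetSum_coeff, coeff_monomial, coeff_zero, Fin.val_inj] at this
    rw [Finset.sum_ite_eq' Finset.univ j, if_pos (Finset.mem_univ j)] at this
    exact congrArg Subtype.val this
  · rw [map_sum, ← hx]
    exact Finset.sum_congr rfl fun i _ ↦ aeval_monomial x

theorem HasClosedForm.descend (hM : HasClosedForm E w₁ w₂ M) (hL : DiffSubfield E L)
    (hstep : AlgStep E L M ∨ LiouvilleStep E L M) (hw₁ : w₁ ∈ L) (hw₂ : w₂ ∈ L)
    (hne : ¬(w₁ = 0 ∧ w₂ = 0)) : HasClosedForm E w₁ w₂ L := by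
  obtain ⟨A₁, hA₁, A₂, hA₂, hw, hA⟩ := hM
  let δ₁ := E.der₁.restrictSubfield L fun x hx ↦ (hL x hx).1
  let δ₂ := E.der₂.restrictSubfield L fun x hx ↦ (hL x hx).2
  have h₁ : ∀ a, E.der₁ (algebraMap L E.carrier a) = algebraMap L E.carrier (δ₁ a) := fun _ ↦ rfl
  have h₂ : ∀ a, E.der₂ (algebraMap L E.carrier a) = algebraMap L E.carrier (δ₂ a) := fun _ ↦ rfl
  suffices h : ∃ B₁ B₂ : L, δ₁ ⟨w₂, hw₂⟩ - δ₂ ⟨w₁, hw₁⟩ = ⟨w₁, hw₁⟩ * B₂ - ⟨w₂, hw₂⟩ * B₁ ∧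
      δ₁ B₂ - δ₂ B₁ = 0 by
    obtain ⟨B₁, B₂, hB, hB'⟩ := h
    exact ⟨B₁, B₁.2, B₂, B₂.2, congrArg Subtype.val hB, congrArg Subtype.val hB'⟩
  have halg : IsAlgebraic L A₁ → IsAlgebraic L A₂ → _ := fun ha₁ ha₂ ↦
    exists_closed_form_of_isAlgebraic (u := δ₁ ⟨w₂, hw₂⟩ - δ₂ ⟨w₁, hw₁⟩) (w₁ := ⟨w₁, hw₁⟩)
      (w₂ := ⟨w₂, hw₂⟩) h₁ h₂ ha₁ ha₂ hw hA
  rcases hstep with hstep | ⟨G, c₁, e₁, c₂, e₂, hc₁, he₁, hc₂, he₂, hG₁, hG₂, rfl⟩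
  · exact halg (isAlgebraic_of_algebraicOver (hstep _ hA₁))
      (isAlgebraic_of_algebraicOver (hstep _ hA₂))
  · have hle : Subfield.closure ((L : Set E.carrier) ∪ {G}) ≤
        (IntermediateField.adjoin L {G}).toSubfield := by
      rw [Subfield.closure_le, Set.union_subset_iff]
      exact ⟨fun x hx ↦ (IntermediateField.adjoin L {G}).algebraMap_mem ⟨x, hx⟩,
        IntermediateField.subset_adjoin L {G}⟩
    by_cases hG : IsAlgebraic L G
    · have := IntermediateField.isAlgebraic_adjoin_simple hG.isIntegral
      have key {A : E.carrier} (hA : A ∈ Subfield.closure ((L : Set E.carrier) ∪ {G})) :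
          IsAlgebraic L A :=
        IntermediateField.isAlgebraic_iff.1
          (Algebra.IsAlgebraic.isAlgebraic (⟨A, hle hA⟩ : IntermediateField.adjoin L {G}))
      exact halg (key hA₁) (key hA₂)
    · exact exists_closed_form_of_transcendental h₁ h₂ (fun a ↦ Subtype.ext (E.comm a)) hG
        (E.comm G) (c₁ := ⟨c₁, hc₁⟩) (e₁ := ⟨e₁, he₁⟩) (c₂ := ⟨c₂, hc₂⟩) (e₂ := ⟨e₂, he₂⟩) hG₁ hG₂
        (fun h ↦ hne ⟨congrArg Subtype.val h.1, congrArg Subtype.val h.2⟩) (hle hA₁) (hle hA₂) hw hA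

theorem HasClosedForm.of_tower (hE : HasClosedForm E w₁ w₂ ⊤) (htower : LiouvilleTower E L)
    (hw₁ : w₁ ∈ L) (hw₂ : w₂ ∈ L) (hne : ¬(w₁ = 0 ∧ w₂ = 0)) : HasClosedForm E w₁ w₂ L := by
  obtain ⟨m, Ks, rfl, hlast, hdiff, hstep⟩ := htower
  have hle (i : Fin (m + 1)) : Ks 0 ≤ Ks i := by
    induction i using Fin.induction with
    | zero => exact le_rfl
    | succ i ih => exact ih.trans (hstep i).1
  have h (i : Fin (m + 1)) : HasClosedForm E w₁ w₂ (Ks i) := by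
    induction i using Fin.reverseInduction with
    | last => rwa [hlast]
    | @cast i ih => exact ih.descend (hdiff _) (hstep i).2 (hle _ hw₁) (hle _ hw₂) hne
  exact h 0

/-- A first integral gives a closed form over the whole field. -/
theorem HasClosedForm.of_first_integral (hne : ¬(w₁ = 0 ∧ w₂ = 0)) {H : E.carrier}
    (hH : E.d₁ H * w₂ - E.d₂ H * w₁ = 0) (hdH : ¬(E.d₁ H = 0 ∧ E.d₂ H = 0)) :
    HasClosedForm E w₁ w₂ ⊤ := by
  obtain ⟨f, hf₁, hf₂⟩ := exists_eq_mul_of_wedge_eq_zero hne hH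
  have hf : f ≠ 0 := by
    rintro rfl
    exact hdH ⟨by rw [hf₁, zero_mul], by rw [hf₂, zero_mul]⟩
  obtain ⟨B₁, B₂, hB⟩ := exists_closed_form_of_integrating_factor (d₁ := E.der₁) (d₂ := E.der₂)
    E.comm (w₁ := w₁) (w₂ := w₂) (c₁ := 0) (c₂ := 0) hf (by rw [map_zero, map_zero]) (by
      rw [zero_mul, zero_mul, add_zero, add_zero, ← hf₁, ← hf₂]
      exact E.comm H)
  exact ⟨B₁, Subfield.mem_top _, B₂, Subfield.mem_top _, hB⟩

end DeltaField

section Extension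

theorem Derivation.eq_of_closure_eq_top {F : Type*} [Field F] {s : Set F}
    (hs : Subfield.closure s = ⊤) {D₁ D₂ : Derivation ℤ F F} (h : Set.EqOn D₁ D₂ s) :
    D₁ = D₂ := by
  ext x
  have hx : x ∈ Subfield.closure s := hs ▸ Subfield.mem_top x
  induction hx using Subfield.closure_induction with
  | mem x hx => exact h hx
  | one => simp
  | add x y _ _ hx hy => simp [hx, hy]
  | neg x _ hx => simp [hx]
  | inv x _ hx => simp [Derivation.leibniz_inv, hx]
  | mul x y _ _ hx hy => simp [hx, hy]

/-- A derivation of a domain extends to its fraction field. -/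
theorem Derivation.exists_extension_fractionRing {A F : Type*} [CommRing A] [IsDomain A] [Field F]
    [Algebra A F] [IsFractionRing A F] (d : Derivation ℤ A A) :
    ∃ D : Derivation ℤ F F, ∀ a, D (algebraMap A F a) = algebraMap A F (d a) := by
  let φ : A →+* TrivSqZeroExt F F :=
    { toFun := fun a ↦ (algebraMap A F a, algebraMap A F (d a))
      map_one' := TrivSqZeroExt.ext (map_one _) (by
        change algebraMap A F (d 1) = 0
        rw [d.map_one_eq_zero, map_zero])
      map_zero' := TrivSqZeroExt.ext (map_zero _) (by
        change algebraMap A F (d 0) = 0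
        rw [d.map_zero, map_zero])
      map_add' := fun a b ↦ TrivSqZeroExt.ext (map_add _ _ _) (by
        change algebraMap A F (d (a + b)) = algebraMap A F (d a) + algebraMap A F (d b)
        rw [d.map_add, map_add])
      map_mul' := fun a b ↦ TrivSqZeroExt.ext (map_mul _ _ _) (by
        change algebraMap A F (d (a * b)) =
          algebraMap A F a * algebraMap A F (d b) + algebraMap A F (d a) * algebraMap A F b
        rw [d.leibniz, map_add, smul_eq_mul, smul_eq_mul, map_mul, map_mul,
          mul_comm (algebraMap A F b)]) }
  have hφ : ∀ y : nonZeroDivisors A, IsUnit (φ y) := fun y ↦ by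
    rw [TrivSqZeroExt.isUnit_iff_isUnit_fst]
    exact IsLocalization.map_units F y
  let ψ : F →+* TrivSqZeroExt F F := IsLocalization.lift hφ
  have hψ (a : A) : ψ (algebraMap A F a) = φ a := IsLocalization.lift_eq hφ a
  have hfst : (TrivSqZeroExt.fstHom ℤ F F).toRingHom.comp ψ = RingHom.id F := by
    apply IsLocalization.ringHom_ext (nonZeroDivisors A)
    ext a
    exact congrArg TrivSqZeroExt.fst (hψ a)
  have hfst' (x : F) : (ψ x).fst = x := RingHom.congr_fun hfst x
  refine ⟨Derivation.mk' (AddMonoidHom.mk' (fun x ↦ (ψ x).snd) fun x y ↦ by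
    rw [map_add, TrivSqZeroExt.snd_add]).toIntLinearMap fun x y ↦ ?_, fun a ↦ ?_⟩
  · change (ψ (x * y)).snd = x * (ψ y).snd + y * (ψ x).snd
    rw [map_mul, TrivSqZeroExt.snd_mul, hfst', hfst', smul_eq_mul, MulOpposite.smul_eq_mul_unop,
      MulOpposite.unop_op, mul_comm y]
  · exact congrArg TrivSqZeroExt.snd (hψ a)

/-- The fraction field of `K[X]` is generated by the constants and `X`. -/
theorem closure_fieldRange_union_X {K F : Type*} [Field K] [Field F] [Algebra K[X] F]
    [IsFractionRing K[X] F] :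
    Subfield.closure ((((algebraMap K[X] F).comp C).fieldRange : Set F) ∪ {algebraMap K[X] F X}) =
      ⊤ := by
  rw [eq_top_iff]
  rintro x -
  have hp (p : K[X]) : algebraMap K[X] F p ∈ Subfield.closure
      ((((algebraMap K[X] F).comp C).fieldRange : Set F) ∪ {algebraMap K[X] F X}) := by
    induction p using Polynomial.induction_on' with
    | add p q hp hq => rw [map_add]; exact add_mem hp hq
    | monomial n a =>
      rw [← C_mul_X_pow_eq_monomial, map_mul, map_pow]
      exact mul_mem (Subfield.subset_closure (.inl ⟨a, rfl⟩))
        (pow_mem (Subfield.subset_closure (.inr rfl)) n)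
  obtain ⟨p, q, -, rfl⟩ := IsFractionRing.div_surjective (A := K[X]) x
  exact div_mem (hp p) (hp q)

/-- Commuting derivations of `K` extend to commuting derivations of the fraction field of `K[X]`
acting on `X` by a compatible affine system. -/
theorem exists_affine_extension {K F : Type*} [Field K] [Field F] [Algebra K[X] F]
    [IsFractionRing K[X] F] {d₁ d₂ : Derivation ℤ K K} (hd : ∀ a, d₁ (d₂ a) = d₂ (d₁ a))
    {c₁ e₁ c₂ e₂ : K} (hc : d₁ c₂ = d₂ c₁) (he : d₁ e₂ + c₂ * e₁ = d₂ e₁ + c₁ * e₂)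
    {ι : K →+* F} (hι : ι = (algebraMap K[X] F).comp C) {G : F} (hG : G = algebraMap K[X] F X) :
    ∃ D₁ D₂ : Derivation ℤ F F, (∀ x, D₁ (D₂ x) = D₂ (D₁ x)) ∧
      (∀ a, D₁ (ι a) = ι (d₁ a)) ∧ (∀ a, D₂ (ι a) = ι (d₂ a)) ∧
      D₁ G = G * ι c₁ + ι e₁ ∧ D₂ G = G * ι c₂ + ι e₂ := by
  have key (d : Derivation ℤ K K) (c e : K) : ∃ D : Derivation ℤ F F,
      (∀ a, D (ι a) = ι (d a)) ∧ D G = G * ι c + ι e := by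
    obtain ⟨D, hD⟩ := Derivation.exists_extension_fractionRing (F := F) (affineDeriv d c e)
    subst hι hG
    refine ⟨D, fun a ↦ (hD (C a)).trans (congrArg _ (affineDeriv_C d c e a)),
      ((hD X).trans (congrArg _ (affineDeriv_X d c e))).trans ?_⟩
    rw [map_add, map_mul, mul_comm]
    rfl
  obtain ⟨D₁, hι₁, hG₁⟩ := key d₁ c₁ e₁
  obtain ⟨D₂, hι₂, hG₂⟩ := key d₂ c₂ e₂
  have htop : Subfield.closure ((ι.fieldRange : Set F) ∪ {G}) = ⊤ := by
    rw [hι, hG]; exact closure_fieldRange_union_X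
  have hcomm : ⁅D₁, D₂⁆ = 0 := by
    refine Derivation.eq_of_closure_eq_top htop ?_
    rintro x (⟨a, rfl⟩ | rfl)
    · rw [Derivation.commutator_apply, hι₂, hι₁, hι₁, hι₂, hd, sub_self, Derivation.zero_apply]
    · rw [Derivation.commutator_apply, hG₁, hG₂, map_add, map_add, D₁.leibniz, D₂.leibniz,
        hι₁, hι₁, hι₂, hι₂, hG₁, hG₂, Derivation.zero_apply]
      have hc' := congrArg ι hc
      have he' := congrArg ι he
      simp only [map_add, map_mul, smul_eq_mul] at hc' he' ⊢
      linear_combination x * hc' + he'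
  refine ⟨D₁, D₂, fun x ↦ sub_eq_zero.1 ?_, hι₁, hι₂, hG₁, hG₂⟩
  rw [← Derivation.commutator_apply, hcomm, Derivation.zero_apply]

/-- Adjoining a transcendental solution of the affine system `δⱼ G = G * cⱼ + eⱼ` to a Δ-field. -/
theorem DeltaField.exists_liouville_extension (K : DeltaField) (c₁ e₁ c₂ e₂ : K.carrier)
    (hc : K.d₁ c₂ = K.d₂ c₁) (he : K.d₁ e₂ + c₂ * e₁ = K.d₂ e₁ + c₁ * e₂) :
    ∃ (E : DeltaField) (ι : K.carrier →+* E.carrier) (G : E.carrier),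
      (∀ x, ι (K.d₁ x) = E.d₁ (ι x)) ∧ (∀ x, ι (K.d₂ x) = E.d₂ (ι x)) ∧ G ≠ 0 ∧
      E.d₁ G = G * ι c₁ + ι e₁ ∧ E.d₂ G = G * ι c₂ + ι e₂ ∧
      Subfield.closure ((ι.fieldRange : Set E.carrier) ∪ {G}) = ⊤ := by
  obtain ⟨F, _, _, _⟩ : ∃ (F : Type) (_ : Field F) (_ : Algebra K.carrier[X] F),
      IsFractionRing K.carrier[X] F := ⟨FractionRing K.carrier[X], inferInstance, inferInstance,
    inferInstance⟩
  obtain ⟨D₁, D₂, hcomm, hι₁, hι₂, hG₁, hG₂⟩ := exists_affine_extension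
    (F := F) (d₁ := K.der₁) (d₂ := K.der₂) K.comm hc he rfl rfl
  let ι := (algebraMap K.carrier[X] F).comp C
  exact ⟨{
      carrier := F
      charZero := charZero_of_injective_ringHom ι.injective
      d₁ := D₁
      d₂ := D₂
      d₁_add := D₁.map_add
      d₁_mul := fun x y ↦ (D₁.leibniz x y).trans (by rw [smul_eq_mul, smul_eq_mul]; ring)
      d₂_add := D₂.map_add
      d₂_mul := fun x y ↦ (D₂.leibniz x y).trans (by rw [smul_eq_mul, smul_eq_mul]; ring)
      comm := hcomm },
    ι, algebraMap K.carrier[X] F X, fun x ↦ (hι₁ x).symm,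
    fun x ↦ (hι₂ x).symm, fun h ↦ X_ne_zero (IsFractionRing.injective K.carrier[X] F
      (h.trans (map_zero _).symm)), hG₁, hG₂,
    closure_fieldRange_union_X⟩

end Extension

/-- Singer's theorem: a foliation `ω = (w₁, w₂)` over a Δ-field `K`
admits a first integral in a Liouvillian tower over `K` if and only if there exist
`A₁, A₂ ∈ K` with `δ₁w₂ − δ₂w₁ = w₁A₂ − w₂A₁` and `δ₁A₂ − δ₂A₁ = 0` (a closed 1-form
`α` with `dω = ω ∧ α`: a Godbillon-Vey sequence of length two). -/
theorem liouville_first_integral_iff_length_two_GV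
    (K : DeltaField) (w₁ w₂ : K.carrier) (hw : ¬(w₁ = 0 ∧ w₂ = 0)) :
    (∃ (E : DeltaField) (ι : K.carrier →+* E.carrier),
      (∀ x, ι (K.d₁ x) = E.d₁ (ι x)) ∧ (∀ x, ι (K.d₂ x) = E.d₂ (ι x)) ∧
      LiouvilleTower E ι.fieldRange ∧
      ∃ H : E.carrier,
        E.d₁ H * ι w₂ - E.d₂ H * ι w₁ = 0 ∧ ¬(E.d₁ H = 0 ∧ E.d₂ H = 0)) ↔
    (∃ A₁ A₂ : K.carrier,
      K.d₁ w₂ - K.d₂ w₁ = w₁ * A₂ - w₂ * A₁ ∧ K.d₁ A₂ - K.d₂ A₁ = 0) := by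
  constructor
  · rintro ⟨E, ι, hι₁, hι₂, htower, H, hH, hdH⟩
    have hne : ¬(ι w₁ = 0 ∧ ι w₂ = 0) := by simpa using hw
    obtain ⟨_, ⟨A₁, rfl⟩, _, ⟨A₂, rfl⟩, hA, hA'⟩ :=
      (DeltaField.HasClosedForm.of_first_integral hne hH hdH).of_tower htower
        (ι.mem_fieldRange_self w₁) (ι.mem_fieldRange_self w₂) hne
    refine ⟨A₁, A₂, ι.injective ?_, ι.injective ?_⟩
    · simpa [hι₁, hι₂] using hA
    · simpa [hι₁, hι₂] using hA'
  · rintro ⟨A₁, A₂, hA, hA'⟩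
    obtain ⟨E₁, ι₁, G, h₁, h₂, hG, hG₁, hG₂, hE₁⟩ := K.exists_liouville_extension A₁ 0 A₂ 0
      (sub_eq_zero.1 hA') (by
        rw [show K.d₁ 0 = 0 from K.der₁.map_zero, show K.d₂ 0 = 0 from K.der₂.map_zero]
        simp)
    rw [map_zero, add_zero] at hG₁ hG₂
    obtain ⟨E₂, ι₂, H, h₁', h₂', -, hH₁, hH₂, hE₂⟩ := E₁.exists_liouville_extension
      0 (G * ι₁ w₁) 0 (G * ι₁ w₂)
      (by rw [show E₁.d₁ 0 = 0 from E₁.der₁.map_zero, show E₁.d₂ 0 = 0 from E₁.der₂.map_zero]) (by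
        have := congrArg ι₁ hA
        simp only [map_sub, map_mul, h₁, h₂] at this
        rw [E₁.d₁_mul, E₁.d₂_mul, hG₁, hG₂]
        linear_combination G * this)
    rw [map_zero, mul_zero, zero_add, map_mul] at hH₁ hH₂
    have hG0 : ι₂ G ≠ 0 := by simpa using hG
    refine ⟨E₂, ι₂.comp ι₁, fun x ↦ by simp [h₁, h₁'], fun x ↦ by simp [h₂, h₂'],
      ⟨2, ![(ι₂.comp ι₁).fieldRange, ι₂.fieldRange, ⊤], rfl, rfl, ?_, ?_⟩, H, ?_, ?_⟩
    · rw [Fin.forall_fin_succ, Fin.forall_fin_two]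
      refine ⟨?_, ?_, fun x _ ↦ ⟨Subfield.mem_top _, Subfield.mem_top _⟩⟩
      · rintro _ ⟨x, rfl⟩
        exact ⟨⟨K.d₁ x, by simp [h₁, h₁']⟩, ⟨K.d₂ x, by simp [h₂, h₂']⟩⟩
      · rintro _ ⟨x, rfl⟩
        exact ⟨⟨E₁.d₁ x, h₁' x⟩, ⟨E₁.d₂ x, h₂' x⟩⟩
    · rw [Fin.forall_fin_two]
      refine ⟨⟨?_, .inr ?_⟩, ⟨le_top, .inr ?_⟩⟩
      · rintro _ ⟨x, rfl⟩
        exact ⟨ι₁ x, rfl⟩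
      · refine ⟨ι₂ G, ι₂ (ι₁ A₁), 0, ι₂ (ι₁ A₂), 0, ⟨A₁, rfl⟩, zero_mem _, ⟨A₂, rfl⟩, zero_mem _,
          ?_, ?_, ?_⟩
        · rw [← h₁', hG₁, map_mul, add_zero]
        · rw [← h₂', hG₂, map_mul, add_zero]
        · change ι₂.fieldRange = _
          rw [RingHom.fieldRange_eq_map, ← hE₁, RingHom.map_field_closure, Set.image_union,
            Set.image_singleton, ← Subfield.coe_map, RingHom.map_fieldRange]
          rfl
      · refine ⟨H, 0, ι₂ (G * ι₁ w₁), 0, ι₂ (G * ι₁ w₂), zero_mem _, ⟨_, rfl⟩, zero_mem _,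
          ⟨_, rfl⟩, ?_, ?_, hE₂.symm⟩
        · rw [hH₁, map_mul, mul_zero, zero_add]
        · rw [hH₂, map_mul, mul_zero, zero_add]
    · rw [hH₁, hH₂, RingHom.comp_apply, RingHom.comp_apply]
      ring
    · rw [hH₁, hH₂]
      simpa [hG0] using hw
end
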